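/- There exist a smooth (C^∞) vector field f : H → H on the real Hilbert space H = ℓ²(ℤ) and a maximal solution γ : (a,b) → H of the autonomous ODE x' = f(x) such that γ is bounded in norm but (a,b) ≠ ℝ (the solution has finite lifetime). -/

import Mathlib

open Set Filter Topology

noncomputable section

namespace BoundedBlowup

/-- The Hilbert space `ℓ²(ℤ)`. -/
abbrev H : Type := lp (fun _ : ℤ => ℝ) 2

/-- The standard basis vectors of `ℓ²(ℤ)`. -/
def basisVec (n : ℤ) : H := lp.single 2 n (1 : ℝ)

lemma basisVec_apply (n m : ℤ) : basisVec n m = if m = n then 1 else 0 := by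
  simp [basisVec, Pi.single_apply]

lemma norm_basisVec (n : ℤ) : ‖basisVec n‖ = 1 := by
  simp [basisVec, lp.norm_single]

lemma contDiff_coord (n : ℤ) {k : WithTop ℕ∞} : ContDiff ℝ k fun x : H => x n :=
  (lp.evalCLM ℝ (fun _ : ℤ => ℝ) 2 n).contDiff

lemma abs_coord_le_norm (x : H) (n : ℤ) : |x n| ≤ ‖x‖ :=
  lp.norm_apply_le_norm two_ne_zero x n

lemma finite_setOf_lt_abs_coord (x : H) {ε : ℝ} (hε : 0 < ε) : {n : ℤ | ε < |x n|}.Finite := by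
  have h := ((memℓp_gen_iff (by norm_num)).1 (lp.memℓp x)).tendsto_cofinite_zero
  have h' := h.eventually_lt_const (show (0 : ℝ) < ε ^ 2 by positivity)
  refine (eventually_cofinite.1 h').subset fun n hn => ?_
  have hn' : ε < |x n| := hn
  simp only [mem_ofPred_eq, not_lt]
  simpa using pow_le_pow_left₀ hε.le hn'.le 2

/-- Smooth step function, `0` on `(-∞, 1/2]` and `1` on `[1, ∞)`. -/
def detector (r : ℝ) : ℝ := Real.smoothTransition (2 * r - 1)

lemma contDiff_detector {k : ℕ∞} : ContDiff ℝ k detector :=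
  Real.smoothTransition.contDiff.comp (by fun_prop)

lemma detector_of_le {r : ℝ} (hr : r ≤ 1 / 2) : detector r = 0 :=
  Real.smoothTransition.zero_of_nonpos (by linarith)

lemma detector_one : detector 1 = 1 :=
  Real.smoothTransition.one_of_one_le (by norm_num)

/-- Smooth bump function, positive exactly on `(1/4, 4)` and equal to `1` exactly on `[1/2, 2]`. -/
def bump (u : ℝ) : ℝ := Real.smoothTransition (4 * u - 1) * Real.smoothTransition (2 - u / 2)

lemma contDiff_bump {k : ℕ∞} : ContDiff ℝ k bump :=
  (Real.smoothTransition.contDiff.comp (by fun_prop)).mul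
    (Real.smoothTransition.contDiff.comp (by fun_prop))

lemma bump_nonneg (u : ℝ) : 0 ≤ bump u :=
  mul_nonneg (Real.smoothTransition.nonneg _) (Real.smoothTransition.nonneg _)

lemma bump_le_one (u : ℝ) : bump u ≤ 1 :=
  mul_le_one₀ (Real.smoothTransition.le_one _) (Real.smoothTransition.nonneg _)
    (Real.smoothTransition.le_one _)

lemma bump_of_le {u : ℝ} (hu : u ≤ 1 / 4) : bump u = 0 := by
  rw [bump, Real.smoothTransition.zero_of_nonpos (by linarith), zero_mul]

lemma bump_of_ge {u : ℝ} (hu : 4 ≤ u) : bump u = 0 := by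
  rw [bump, Real.smoothTransition.zero_of_nonpos (x := 2 - u / 2) (by linarith), mul_zero]

lemma bump_of_mem {u : ℝ} (h₁ : 1 / 2 ≤ u) (h₂ : u ≤ 2) : bump u = 1 := by
  rw [bump, Real.smoothTransition.one_of_one_le (by linarith),
    Real.smoothTransition.one_of_one_le (by linarith), mul_one]

lemma deriv_bump_of_eq_zero {u : ℝ} (hu : bump u = 0) : deriv bump u = 0 :=
  IsLocalMin.deriv_eq_zero (Eventually.of_forall fun v => by rw [hu]; exact bump_nonneg v)

lemma deriv_bump_of_eq_one {u : ℝ} (hu : bump u = 1) : deriv bump u = 0 :=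
  IsLocalMax.deriv_eq_zero (Eventually.of_forall fun v => by rw [hu]; exact bump_le_one v)

/-- Wherever `bump` varies, exactly one of its two dyadic neighbours is detected. -/
lemma deriv_bump_mul_detector (u : ℝ) :
    deriv bump u * (detector (bump (u / 2)) + detector (bump (2 * u))) = deriv bump u := by
  by_cases h₀ : bump u = 0
  · simp [deriv_bump_of_eq_zero h₀]
  by_cases h₁ : bump u = 1
  · simp [deriv_bump_of_eq_one h₁]
  have hl : 1 / 4 < u := by
    by_contra! h
    exact h₀ (bump_of_le h)
  have hr : u < 4 := by
    by_contra! h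
    exact h₀ (bump_of_ge h)
  have h0 : detector 0 = 0 := detector_of_le (by norm_num)
  rcases lt_or_ge u (1 / 2) with h | h
  · rw [bump_of_le (u := u / 2) (by linarith), bump_of_mem (u := 2 * u) (by linarith) (by linarith),
      h0, detector_one]
    ring
  · have h2 : 2 < u := by
      by_contra! h'
      exact h₁ (bump_of_mem h h')
    rw [bump_of_mem (u := u / 2) (by linarith) (by linarith), bump_of_ge (u := 2 * u) (by linarith),
      h0, detector_one]
    ring

/-- The coefficients of the vector field; the coordinate `x (-5)` plays the role of time. -/
def coeff (n : ℤ) (x : H) : ℝ :=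
  2 ^ n * (deriv bump (2 ^ n * x (-5)) * (detector (x (n - 1)) + detector (x (n + 1))))

lemma contDiff_coeff (n : ℤ) : ContDiff ℝ (⊤ : ℕ∞) (coeff n) := by
  have hb : ContDiff ℝ (⊤ : ℕ∞) (deriv bump) :=
    (contDiff_bump (k := ⊤)).iterate_deriv 1
  have hd (m : ℤ) : ContDiff ℝ (⊤ : ℕ∞) fun x : H => detector (x m) :=
    contDiff_detector.comp (contDiff_coord m)
  exact contDiff_const.mul
    ((hb.comp (contDiff_const.mul (contDiff_coord (-5)))).mul ((hd _).add (hd _)))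

lemma locallyFinite_support_coeff :
    LocallyFinite fun n : ℤ => Function.support fun x : H => coeff n x • basisVec n := by
  intro x
  have hF := finite_setOf_lt_abs_coord x (ε := 1 / 4) (by norm_num)
  refine ⟨Metric.ball x (1 / 4), Metric.ball_mem_nhds _ (by norm_num),
    ((hF.preimage (f := fun n : ℤ => n - 1) (by simp [sub_left_injective.injOn])).union
      (hF.preimage (f := fun n : ℤ => n + 1) (by simp [add_left_injective _ |>.injOn]))).subset ?_⟩
  rintro n ⟨y, hy, hyx⟩
  have key (m : ℤ) (hm : |x m| ≤ 1 / 4) : detector (y m) = 0 := by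
    have h₁ : |y m - x m| < 1 / 4 :=
      (abs_coord_le_norm (y - x) m).trans_lt (by simpa [dist_eq_norm] using hyx)
    apply detector_of_le
    linarith [le_abs_self (x m), le_abs_self (y m - x m)]
  by_contra! hn
  simp only [mem_union, mem_preimage, mem_ofPred_eq, not_or, not_lt] at hn
  refine hy ?_
  simp [coeff, key _ hn.1, key _ hn.2]

/-- The direction field, tangent to `curve` along it. -/
def direction (x : H) : H := basisVec (-5) + ∑ᶠ n : ℤ, coeff n x • basisVec n

lemma contDiff_direction : ContDiff ℝ (⊤ : ℕ∞) direction := by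
  refine contDiff_const.add ?_
  rw [← contMDiff_iff_contDiff]
  refine contMDiff_finsum (fun n => ?_) locallyFinite_support_coeff
  exact ((contDiff_coeff n).smul contDiff_const).contMDiff

/-- A bounded curve in `ℓ²(ℤ)` without limit at `0`. -/
def curve (σ : ℝ) : H := σ • basisVec (-5) + ∑ᶠ n : ℤ, bump (2 ^ n * σ) • basisVec n

lemma bump_zpow_eq_zero {k n : ℤ} {σ : ℝ} (hσ : σ ∈ Ioo ((2 : ℝ) ^ (k - 1)) (2 ^ (k + 1)))
    (hn : n ∉ Finset.Icc (-k - 2) (-k + 2)) : bump (2 ^ n * σ) = 0 := by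
  have h2 : (0 : ℝ) < 2 ^ n := by positivity
  rw [Finset.mem_Icc, not_and_or, not_le, not_le] at hn
  rcases hn with hn | hn
  · apply bump_of_le
    calc (2 : ℝ) ^ n * σ ≤ 2 ^ n * 2 ^ (k + 1) := by gcongr; exact hσ.2.le
      _ = 2 ^ (n + (k + 1)) := (zpow_add₀ two_ne_zero _ _).symm
      _ ≤ 2 ^ (-2 : ℤ) := zpow_le_zpow_right₀ one_le_two (by lia)
      _ = 1 / 4 := by norm_num
  · apply bump_of_ge
    calc (4 : ℝ) = 2 ^ (2 : ℤ) := by norm_num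
      _ ≤ 2 ^ (n + (k - 1)) := zpow_le_zpow_right₀ one_le_two (by lia)
      _ = 2 ^ n * 2 ^ (k - 1) := zpow_add₀ two_ne_zero _ _
      _ ≤ 2 ^ n * σ := by gcongr; exact hσ.1.le

lemma exists_mem_dyadic {σ : ℝ} (hσ : 0 < σ) :
    ∃ k : ℤ, σ ∈ Ioo ((2 : ℝ) ^ (k - 1)) (2 ^ (k + 1)) := by
  obtain ⟨k, hk⟩ := exists_mem_Ico_zpow hσ one_lt_two
  exact ⟨k, (zpow_lt_zpow_right₀ one_lt_two (by lia)).trans_le hk.1, hk.2⟩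

lemma curve_eq_sum {k : ℤ} {σ : ℝ} (hσ : σ ∈ Ioo ((2 : ℝ) ^ (k - 1)) (2 ^ (k + 1))) :
    curve σ = σ • basisVec (-5) +
      ∑ n ∈ Finset.Icc (-k - 2) (-k + 2), bump (2 ^ n * σ) • basisVec n := by
  rw [curve, finsum_eq_sum_of_support_subset]
  intro n hn
  by_contra h
  exact hn (by simp [bump_zpow_eq_zero hσ (by simpa using h)])

lemma curve_apply {σ : ℝ} (hσ : 0 < σ) (m : ℤ) :
    curve σ m = (if m = -5 then σ else 0) + bump (2 ^ m * σ) := by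
  obtain ⟨k, hk⟩ := exists_mem_dyadic hσ
  rw [curve_eq_sum hk]
  simp only [lp.coeFn_add, lp.coeFn_smul, lp.coeFn_sum, Pi.add_apply, Pi.smul_apply,
    Finset.sum_apply, basisVec_apply, smul_eq_mul, mul_ite, mul_one, mul_zero, Finset.sum_ite_eq]
  split_ifs with h₁ h₂ h₂ <;> first | rfl | rw [bump_zpow_eq_zero hk h₂]

lemma norm_curve_le {σ : ℝ} (h₀ : 0 < σ) (h₁ : σ ≤ 1) : ‖curve σ‖ ≤ 6 := by
  obtain ⟨k, hk⟩ := exists_mem_dyadic h₀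
  rw [curve_eq_sum hk]
  have hs : ‖∑ n ∈ Finset.Icc (-k - 2) (-k + 2), bump (2 ^ n * σ) • basisVec n‖ ≤ 5 := by
    refine (norm_sum_le_of_le _ (f := fun n => bump (2 ^ n * σ) • basisVec n)
      (n := fun _ => (1 : ℝ)) fun n _ => ?_).trans ?_
    · rw [norm_smul, norm_basisVec, mul_one, Real.norm_of_nonneg (bump_nonneg _)]
      exact bump_le_one _
    · have : (-k + 2 + 1 - (-k - 2)).toNat = 5 := by lia
      simp [this]
  have ht : ‖σ • basisVec (-5)‖ ≤ 1 := by
    rw [norm_smul, norm_basisVec, mul_one, Real.norm_of_nonneg h₀.le]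
    exact h₁
  linarith [norm_add_le (σ • basisVec (-5))
    (∑ n ∈ Finset.Icc (-k - 2) (-k + 2), bump (2 ^ n * σ) • basisVec n)]

lemma one_le_norm_curve {σ : ℝ} (hσ : 0 < σ) : 1 ≤ ‖curve σ‖ := by
  obtain ⟨k, hk⟩ := exists_mem_Ico_zpow hσ one_lt_two
  have hb : bump (2 ^ (-k) * σ) = 1 := by
    have h2 : (0 : ℝ) < 2 ^ (-k) := by positivity
    have h : (2 : ℝ) ^ (-k) * 2 ^ k = 1 := by rw [← zpow_add₀ two_ne_zero]; simp
    have h' : (2 : ℝ) ^ (-k) * 2 ^ (k + 1) = 2 := by rw [← zpow_add₀ two_ne_zero]; simp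
    apply bump_of_mem
    · linarith [mul_le_mul_of_nonneg_left hk.1 h2.le]
    · linarith [mul_le_mul_of_nonneg_left hk.2.le h2.le]
  refine le_trans ?_ ((le_abs_self _).trans (abs_coord_le_norm (curve σ) (-k)))
  rw [curve_apply hσ, hb]
  split_ifs <;> linarith

lemma tendsto_curve_apply (m : ℤ) : Tendsto (fun σ => curve σ m) (𝓝[>] 0) (𝓝 0) := by
  have hc : Continuous fun σ : ℝ => (if m = -5 then σ else 0) + bump (2 ^ m * σ) := by
    have hb : Continuous bump := (contDiff_bump (k := 0)).continuous
    split_ifs <;> fun_prop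
  have h0 : (if m = -5 then (0 : ℝ) else 0) + bump (2 ^ m * 0) = 0 := by
    simp [bump_of_le (u := 0) (by norm_num)]
  have ht := (hc.tendsto 0).mono_left (nhdsWithin_le_nhds (s := Ioi 0))
  rw [h0] at ht
  refine ht.congr' ?_
  filter_upwards [self_mem_nhdsWithin] with σ hσ
  exact (curve_apply hσ m).symm

lemma coeff_curve {σ : ℝ} (h₀ : 0 < σ) (h₁ : σ < 1) (n : ℤ) :
    coeff n (curve σ) = 2 ^ n * deriv bump (2 ^ n * σ) := by
  have hsmall (m : ℤ) (hm : m ≤ -2) : bump (2 ^ m * σ) = 0 := by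
    apply bump_of_le
    calc (2 : ℝ) ^ m * σ ≤ 2 ^ m * 1 := by gcongr
      _ ≤ 2 ^ (-2 : ℤ) := by rw [mul_one]; exact zpow_le_zpow_right₀ one_le_two hm
      _ = 1 / 4 := by norm_num
  have ht : curve σ (-5) = σ := by
    rw [curve_apply h₀, hsmall (-5) (by norm_num)]
    simp
  rw [coeff, ht]
  congr 1
  by_cases hn : n ≤ -2
  · simp [deriv_bump_of_eq_zero (hsmall n hn)]
  · have e₁ : (2 : ℝ) ^ (n - 1) * σ = 2 ^ n * σ / 2 := by rw [zpow_sub_one₀ two_ne_zero]; ring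
    have e₂ : (2 : ℝ) ^ (n + 1) * σ = 2 * (2 ^ n * σ) := by rw [zpow_add_one₀ two_ne_zero]; ring
    rw [curve_apply h₀, curve_apply h₀, if_neg (by lia), if_neg (by lia), zero_add, zero_add,
      e₁, e₂, deriv_bump_mul_detector]

lemma hasDerivAt_curve {σ : ℝ} (h₀ : 0 < σ) (h₁ : σ < 1) :
    HasDerivAt curve (direction (curve σ)) σ := by
  obtain ⟨k, hk⟩ := exists_mem_dyadic h₀
  have hdir : direction (curve σ) = (1 : ℝ) • basisVec (-5) +
      ∑ n ∈ Finset.Icc (-k - 2) (-k + 2), (deriv bump (2 ^ n * σ) * (2 ^ n * 1)) • basisVec n := by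
    rw [direction, one_smul, finsum_eq_sum_of_support_subset (s := Finset.Icc (-k - 2) (-k + 2))]
    · congr 1
      refine Finset.sum_congr rfl fun n _ => ?_
      rw [coeff_curve h₀ h₁, mul_one, mul_comm]
    · intro n hn
      by_contra h
      exact hn (by
        simp [coeff_curve h₀ h₁, deriv_bump_of_eq_zero (bump_zpow_eq_zero hk (by simpa using h))])
  rw [hdir]
  have hsum : HasDerivAt (fun τ : ℝ => τ • basisVec (-5) +
      ∑ n ∈ Finset.Icc (-k - 2) (-k + 2), bump (2 ^ n * τ) • basisVec n)
      ((1 : ℝ) • basisVec (-5) + ∑ n ∈ Finset.Icc (-k - 2) (-k + 2),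
        (deriv bump (2 ^ n * σ) * (2 ^ n * 1)) • basisVec n) σ := by
    refine ((hasDerivAt_id σ).smul_const _).add (HasDerivAt.fun_sum fun n _ => ?_)
    have hb : HasDerivAt bump (deriv bump (2 ^ n * σ)) (2 ^ n * σ) :=
      ((contDiff_bump (k := 1)).differentiable (by simp) _).hasDerivAt
    exact (hb.comp σ ((hasDerivAt_id σ).const_mul _)).smul_const _
  refine hsum.congr_of_eventuallyEq ?_
  filter_upwards [isOpen_Ioo.mem_nhds hk] with τ hτ using curve_eq_sum hτ

/-- The vector field: the direction field, slowed down so that the time coordinate stays below `1`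
along the solution. -/
def field (x : H) : H := (1 - x (-5)) • direction x

lemma contDiff_field : ContDiff ℝ (⊤ : ℕ∞) field :=
  (contDiff_const.sub (contDiff_coord (-5))).smul contDiff_direction

/-- The solution of the vector field on `(0, ∞)`. -/
def solution (t : ℝ) : H := curve (1 - Real.exp (-t))

lemma one_sub_exp_neg_mem {t : ℝ} (ht : 0 < t) : 1 - Real.exp (-t) ∈ Ioo (0 : ℝ) 1 :=
  ⟨by simpa using ht, by simpa using Real.exp_pos (-t)⟩

lemma hasDerivAt_solution {t : ℝ} (ht : 0 < t) :
    HasDerivAt solution (field (solution t)) t := by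
  obtain ⟨h₀, h₁⟩ := one_sub_exp_neg_mem ht
  have hτ : HasDerivAt (fun t : ℝ => 1 - Real.exp (-t)) (Real.exp (-t)) t := by
    simpa using ((hasDerivAt_neg t).exp).const_sub 1
  have hx : 1 - solution t (-5) = Real.exp (-t) := by
    rw [solution, curve_apply h₀, if_pos rfl, bump_of_le]
    · ring
    · norm_num
      linarith
  rw [field, hx]
  exact (hasDerivAt_curve h₀ h₁).scomp t hτ

lemma not_continuousAt_extension {γ : ℝ → H} (hγ : ∀ t ∈ Ioi (0 : ℝ), γ t = solution t) :
    ¬ ContinuousAt γ 0 := by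
  intro hc
  have hτ : Tendsto (fun t : ℝ => 1 - Real.exp (-t)) (𝓝[>] 0) (𝓝[>] 0) := by
    refine tendsto_nhdsWithin_iff.2 ⟨?_, ?_⟩
    · have h : Continuous fun t : ℝ => 1 - Real.exp (-t) := by fun_prop
      simpa using (h.tendsto 0).mono_left (nhdsWithin_le_nhds (s := Ioi 0))
    · filter_upwards [self_mem_nhdsWithin] with t ht using (one_sub_exp_neg_mem ht).1
  have hlim : Tendsto γ (𝓝[>] 0) (𝓝 (γ 0)) := hc.tendsto.mono_left nhdsWithin_le_nhds
  have hzero : γ 0 = 0 := by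
    ext m
    have h₁ : Tendsto (fun t => γ t m) (𝓝[>] 0) (𝓝 (γ 0 m)) :=
      ((contDiff_coord m (k := 0)).continuous.tendsto _).comp hlim
    refine tendsto_nhds_unique h₁ (((tendsto_curve_apply m).comp hτ).congr' ?_)
    filter_upwards [self_mem_nhdsWithin] with t ht
    rw [hγ t ht]
    rfl
  have hnorm : (1 : ℝ) ≤ ‖γ 0‖ := by
    refine ge_of_tendsto hlim.norm ?_
    filter_upwards [self_mem_nhdsWithin] with t ht
    rw [hγ t ht]
    exact one_le_norm_curve (one_sub_exp_neg_mem ht).1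
  rw [hzero, norm_zero] at hnorm
  linarith

end BoundedBlowup

end


/-- There exist a smooth vector field `f` on `H = ℓ²(ℤ)` and a maximal
solution `γ` of the autonomous ODE `x' = f(x)`, defined on a nonempty open
interval `s ≠ ℝ`, which is bounded in norm. Maximality means that any solution
on a larger open interval extending `γ` already has domain `s`. -/
theorem stmt19 :
    ∃ f : lp (fun _ : ℤ => ℝ) 2 → lp (fun _ : ℤ => ℝ) 2,
      ContDiff ℝ (⊤ : ℕ∞) f ∧
      ∃ (s : Set ℝ) (γ : ℝ → lp (fun _ : ℤ => ℝ) 2),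
        IsOpen s ∧ s.OrdConnected ∧ s.Nonempty ∧
        (∀ t ∈ s, HasDerivAt γ (f (γ t)) t) ∧
        (∃ C : ℝ, ∀ t ∈ s, ‖γ t‖ ≤ C) ∧
        s ≠ Set.univ ∧
        (∀ (s' : Set ℝ) (γ' : ℝ → lp (fun _ : ℤ => ℝ) 2),
          IsOpen s' → s'.OrdConnected → s ⊆ s' →
          (∀ t ∈ s', HasDerivAt γ' (f (γ' t)) t) →
          (∀ t ∈ s, γ' t = γ t) → s' = s) := by
  refine ⟨BoundedBlowup.field, BoundedBlowup.contDiff_field, Ioi 0, BoundedBlowup.solution,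
    isOpen_Ioi, ordConnected_Ioi, nonempty_Ioi, fun t ht => BoundedBlowup.hasDerivAt_solution ht,
    ⟨6, fun t ht => ?_⟩, fun h => ?_, fun s' γ' _ hconn hsub hderiv hγ' => ?_⟩
  · obtain ⟨h₀, h₁⟩ := BoundedBlowup.one_sub_exp_neg_mem ht
    exact BoundedBlowup.norm_curve_le h₀ h₁.le
  · exact lt_irrefl (0 : ℝ) (h.symm ▸ mem_univ (0 : ℝ) : (0 : ℝ) ∈ Ioi 0)
  · refine Subset.antisymm (fun b hb => ?_) hsub
    by_contra hb'
    have h0 : (0 : ℝ) ∈ s' :=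
      hconn.out hb (hsub (mem_Ioi.2 one_pos)) ⟨not_lt.1 hb', zero_le_one⟩
    exact BoundedBlowup.not_continuousAt_extension hγ' (hderiv 0 h0).continuousAt
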